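/- In an arbitrage-free discrete market model with proportional transaction costs, for an American option with adapted ℝ²-valued payoff process (ξ,ζ), the infimum defining the seller's price π^a(ξ,ζ) is attained, and π^a(ξ,ζ) = max over mixed stopping times χ of the maximum over pairs (P,S) ∈ barP(χ) of E_P((ξ + Sζ)_χ); in particular, there exist a mixed stopping time χ̂ and a pair (P̂,Ŝ) ∈ barP(χ̂) with π^a(ξ,ζ) = E_{P̂}((ξ + Ŝζ)_{χ̂}), and for every mixed stopping time χ and every (P,S) ∈ barP(χ) one has E_P((ξ + Sζ)_χ) ≤ π^a(ξ,ζ). -/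

import Mathlib

open MeasureTheory
open scoped Pointwise

noncomputable section

namespace RZ

variable {Ω : Type*} [Fintype Ω]

/-- `ω` and `ω'` lie in the same atom of the σ-field `m`. -/
def sameAtom (m : MeasurableSpace Ω) (ω ω' : Ω) : Prop :=
  ∀ A : Set Ω, MeasurableSet[m] A → (ω ∈ A ↔ ω' ∈ A)

/-- Elementary conditional expectation w.r.t. a σ-field on a finite space:
at `ω` it is the `P`-average of `f` over the atom of `ω`. -/
def condExp (m : MeasurableSpace Ω) (P : Ω → ℝ) (f : Ω → ℝ) (ω : Ω) : ℝ :=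
  (∑ ω' : Ω, Set.indicator {ω'' | sameAtom m ω ω''} (fun ω'' => P ω'' * f ω'') ω') /
  (∑ ω' : Ω, Set.indicator {ω'' | sameAtom m ω ω''} P ω')

/-- Expectation under `P`. -/
def expect (P : Ω → ℝ) (f : Ω → ℝ) : ℝ := ∑ ω : Ω, P ω * f ω

/-- Discrete market model with proportional transaction costs. -/
structure Market (Ω : Type*) [Fintype Ω] where
  T : ℕ
  T_pos : 0 < T
  F : ℕ → MeasurableSpace Ω
  F_mono : ∀ ⦃s t : ℕ⦄, s ≤ t → F s ≤ F t
  F_zero : F 0 = ⊥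
  F_top : F T = ⊤
  Q : Ω → ℝ
  Q_pos : ∀ ω, 0 < Q ω
  Q_sum : ∑ ω, Q ω = 1
  Sb : ℕ → Ω → ℝ
  Sa : ℕ → Ω → ℝ
  Sb_pos : ∀ t ω, t ≤ T → 0 < Sb t ω
  Sb_le_Sa : ∀ t ω, t ≤ T → Sb t ω ≤ Sa t ω
  Sb_adapted : ∀ t, t ≤ T → Measurable[F t] (Sb t)
  Sa_adapted : ∀ t, t ≤ T → Measurable[F t] (Sa t)

variable (M : Market Ω)

/-- Liquidation value θ_t(γ, δ) in scenario ω, for a cash position γ and stock position δ. -/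
def liq (t : ℕ) (ω : Ω) (γ δ : ℝ) : ℝ :=
  γ + M.Sb t ω * max δ 0 - M.Sa t ω * max (-δ) 0

/-- An adapted (real-valued) process. -/
def IsAdapted (X : ℕ → Ω → ℝ) : Prop := ∀ t, t ≤ M.T → Measurable[M.F t] (X t)

/-- An adapted ℝ²-valued payoff process. -/
def AdaptedPair (ξ ζ : ℕ → Ω → ℝ) : Prop := IsAdapted M ξ ∧ IsAdapted M ζ

/-- Self-financing strategy. -/
def SelfFinancing (α β : ℕ → Ω → ℝ) : Prop :=
  Measurable[M.F 0] (α 0) ∧ Measurable[M.F 0] (β 0) ∧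
  (∀ t, t < M.T → Measurable[M.F t] (α (t + 1)) ∧ Measurable[M.F t] (β (t + 1))) ∧
  (∀ t, t < M.T → ∀ ω, 0 ≤ liq M t ω (α t ω - α (t + 1) ω) (β t ω - β (t + 1) ω))

/-- Pure stopping time with values in {0,...,T}. -/
def IsStop (τ : Ω → ℕ) : Prop :=
  (∀ ω, τ ω ≤ M.T) ∧ ∀ t : ℕ, MeasurableSet[M.F t] {ω | τ ω = t}

/-- Seller superhedging strategy. -/
def SellerHedge (ξ ζ α β : ℕ → Ω → ℝ) : Prop :=
  SelfFinancing M α β ∧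
  ∀ τ, IsStop M τ → ∀ ω,
    0 ≤ liq M (τ ω) ω (α (τ ω) ω - ξ (τ ω) ω) (β (τ ω) ω - ζ (τ ω) ω)

/-- Buyer superhedging strategy. -/
def BuyerHedge (ξ ζ α β : ℕ → Ω → ℝ) : Prop :=
  SelfFinancing M α β ∧
  ∃ τ, IsStop M τ ∧ ∀ ω,
    0 ≤ liq M (τ ω) ω (α (τ ω) ω + ξ (τ ω) ω) (β (τ ω) ω + ζ (τ ω) ω)

/-- Seller's (ask) price: infimum of the initial costs of seller superhedging strategies. -/
def askPrice (ξ ζ : ℕ → Ω → ℝ) : ℝ :=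
  sInf {x | ∃ α β, SellerHedge M ξ ζ α β ∧ ∀ ω, x = -liq M 0 ω (-α 0 ω) (-β 0 ω)}

/-- Buyer's (bid) price: supremum of the amounts raised by buyer superhedging strategies. -/
def bidPrice (ξ ζ : ℕ → Ω → ℝ) : ℝ :=
  sSup {x | ∃ α β, BuyerHedge M ξ ζ α β ∧ ∀ ω, x = liq M 0 ω (-α 0 ω) (-β 0 ω)}

/-- Mixed stopping time. -/
def IsMixedStop (χ : ℕ → Ω → ℝ) : Prop :=
  (∀ t, t ≤ M.T → Measurable[M.F t] (χ t)) ∧ (∀ t ω, 0 ≤ χ t ω) ∧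
  ∀ ω, ∑ t ∈ Finset.range (M.T + 1), χ t ω = 1

/-- χ*_t = Σ_{s=t}^T χ_s  (so χ*_{T+1} = 0). -/
def chiStar (χ : ℕ → Ω → ℝ) (t : ℕ) (ω : Ω) : ℝ := ∑ s ∈ Finset.Icc t M.T, χ s ω

/-- Z^{χ*}_t = Σ_{s=t}^T χ_s Z_s  (so Z^{χ*}_{T+1} = 0). -/
def starVal (χ Z : ℕ → Ω → ℝ) (t : ℕ) (ω : Ω) : ℝ :=
  ∑ s ∈ Finset.Icc t M.T, χ s ω * Z s ω

/-- Z_χ = Σ_{t=0}^T χ_t Z_t. -/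
def mixVal (χ Z : ℕ → Ω → ℝ) (ω : Ω) : ℝ :=
  ∑ t ∈ Finset.range (M.T + 1), χ t ω * Z t ω

/-- Membership in the family barP(χ). -/
def memBarP (χ : ℕ → Ω → ℝ) (P : Ω → ℝ) (S : ℕ → Ω → ℝ) : Prop :=
  (∀ ω, 0 ≤ P ω) ∧ (∑ ω, P ω) = 1 ∧ IsAdapted M S ∧
  (∀ t ω, t ≤ M.T → M.Sb t ω ≤ S t ω ∧ S t ω ≤ M.Sa t ω) ∧
  (∀ t, t ≤ M.T → ∀ ω, 0 < P ω →
    chiStar M χ (t + 1) ω * M.Sb t ω ≤ condExp (M.F t) P (starVal M χ S (t + 1)) ω ∧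
    condExp (M.F t) P (starVal M χ S (t + 1)) ω ≤ chiStar M χ (t + 1) ω * M.Sa t ω)

/-- Membership in the family P(χ): barP(χ) with P equivalent to Q. -/
def memP (χ : ℕ → Ω → ℝ) (P : Ω → ℝ) (S : ℕ → Ω → ℝ) : Prop :=
  memBarP M χ P S ∧ ∀ ω, 0 < P ω

/-- The mixed stopping time χ^τ associated with a pure stopping time τ. -/
def pureChi (τ : Ω → ℕ) : ℕ → Ω → ℝ := fun t ω => if τ ω = t then 1 else 0

/-- Arbitrage-free: there is an equivalent probability measure and a martingale
between the bid and ask prices. -/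
def ArbitrageFree : Prop :=
  ∃ (P : Ω → ℝ) (S : ℕ → Ω → ℝ),
    (∀ ω, 0 < P ω) ∧ (∑ ω, P ω) = 1 ∧ IsAdapted M S ∧
    (∀ t ω, t ≤ M.T → M.Sb t ω ≤ S t ω ∧ S t ω ≤ M.Sa t ω) ∧
    (∀ t, t < M.T → ∀ ω, 0 < P ω → condExp (M.F t) P (S (t + 1)) ω = S t ω)

/-- Epigraph of a function ℝ → ℝ, as a subset of ℝ² (first coordinate dominates). -/
def epi (f : ℝ → ℝ) : Set (ℝ × ℝ) := {p | f p.2 ≤ p.1}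

/-- The function h_{[b,a]}(y) = a y⁻ − b y⁺. -/
def hfun (b a : ℝ) (y : ℝ) : ℝ := a * max (-y) 0 - b * max y 0

/-- Seller's payoff function u_t(y) = ξ_t + (y − ζ_t)⁻ S^a_t − (y − ζ_t)⁺ S^b_t. -/
def uSell (ξ ζ : ℕ → Ω → ℝ) (t : ℕ) (ω : Ω) (y : ℝ) : ℝ :=
  ξ t ω + M.Sa t ω * max (ζ t ω - y) 0 - M.Sb t ω * max (y - ζ t ω) 0

/-- Buyer's payoff function u_t(y) = −ξ_t + (y + ζ_t)⁻ S^a_t − (y + ζ_t)⁺ S^b_t. -/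
def uBuy (ξ ζ : ℕ → Ω → ℝ) (t : ℕ) (ω : Ω) (y : ℝ) : ℝ :=
  -ξ t ω + M.Sa t ω * max (-(y + ζ t ω)) 0 - M.Sb t ω * max (y + ζ t ω) 0

/-- The seller's pricing recursion: one function per atom,
`z_T = u_T` and `epi z_{t-1} = epi u_{t-1} ∩ (epi h + ⋂_{succ} epi z_t)`. -/
def SellerRec (ξ ζ : ℕ → Ω → ℝ) (z : ℕ → Ω → ℝ → ℝ) : Prop :=
  (∀ t ω ω', t ≤ M.T → sameAtom (M.F t) ω ω' → z t ω = z t ω') ∧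
  (∀ ω, z M.T ω = uSell M ξ ζ M.T ω) ∧
  (∀ t ω, t < M.T →
    epi (z t ω) = epi (uSell M ξ ζ t ω) ∩
      (epi (hfun (M.Sb t ω) (M.Sa t ω)) +
        ⋂ ω' ∈ {ω'' | sameAtom (M.F t) ω ω''}, epi (z (t + 1) ω')))

/-- The buyer's pricing recursion: one function per atom,
`z_T = u_T` and `epi z_{t-1} = epi u_{t-1} ∪ (epi h + ⋂_{succ} epi z_t)`. -/
def BuyerRec (ξ ζ : ℕ → Ω → ℝ) (z : ℕ → Ω → ℝ → ℝ) : Prop :=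
  (∀ t ω ω', t ≤ M.T → sameAtom (M.F t) ω ω' → z t ω = z t ω') ∧
  (∀ ω, z M.T ω = uBuy M ξ ζ M.T ω) ∧
  (∀ t ω, t < M.T →
    epi (z t ω) = epi (uBuy M ξ ζ t ω) ∪
      (epi (hfun (M.Sb t ω) (M.Sa t ω)) +
        ⋂ ω' ∈ {ω'' | sameAtom (M.F t) ω ω''}, epi (z (t + 1) ω')))

/-! ### Linear programming duality -/

/-- **Farkas' lemma** for finitely many linear functionals on a real vector space. -/
theorem farkas {E ι : Type*} [AddCommGroup E] [Module ℝ E] (s : Finset ι) (f : ι → E →ₗ[ℝ] ℝ)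
    (g : E →ₗ[ℝ] ℝ) (h : ∀ x, (∀ i ∈ s, 0 ≤ f i x) → 0 ≤ g x) :
    ∃ l : ι → ℝ, (∀ i, 0 ≤ l i) ∧ ∀ x, g x = ∑ i ∈ s, l i * f i x := by
  classical
  induction s using Finset.induction_on generalizing f g with
  | empty =>
    refine ⟨0, fun _ => le_rfl, fun x => ?_⟩
    have h1 := h x (by simp)
    have h2 := h (-x) (by simp)
    rw [map_neg] at h2
    rw [Finset.sum_empty]
    linarith
  | insert j s hj ih =>
    by_cases hc : ∀ x, (∀ i ∈ s, 0 ≤ f i x) → 0 ≤ g x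
    · obtain ⟨l, hl, hlg⟩ := ih f g hc
      refine ⟨Function.update l j 0, fun i => ?_, fun x => ?_⟩
      · by_cases hi : i = j
        · simp [hi]
        · simpa [hi] using hl i
      · rw [Finset.sum_insert hj, hlg x, Function.update_self, zero_mul, zero_add]
        refine Finset.sum_congr rfl fun i hi => ?_
        rw [Function.update_of_ne (ne_of_mem_of_not_mem hi hj)]
    · push Not at hc
      obtain ⟨x₁, hx₁, hgx₁⟩ := hc
      have hfx₁ : f j x₁ < 0 := by
        by_contra! hn
        exact absurd (h x₁ (by simpa using ⟨hn, hx₁⟩)) (not_le.2 hgx₁)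
      obtain ⟨x₀, hx₀, hgx₀, hfx₀⟩ :
          ∃ x₀, (∀ i ∈ s, 0 ≤ f i x₀) ∧ g x₀ < 0 ∧ f j x₀ = -1 := by
        have hk : 0 < (-f j x₁)⁻¹ := inv_pos.2 (neg_pos.2 hfx₁)
        refine ⟨(-f j x₁)⁻¹ • x₁, fun i hi => ?_, ?_, ?_⟩
        · simpa using mul_nonneg hk.le (hx₁ i hi)
        · simpa using mul_neg_of_pos_of_neg hk hgx₁
        · rw [map_smul, smul_eq_mul, inv_neg, neg_mul, inv_mul_cancel₀ hfx₁.ne]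
      obtain ⟨l, hl, hlg⟩ := ih (fun i => f i + f i x₀ • f j) (g + g x₀ • f j) (by
        intro x hx
        have := h (x + f j x • x₀) (by
          intro i hi
          rcases Finset.mem_insert.1 hi with rfl | hi
          · simp [hfx₀]
          · simpa [mul_comm] using hx i hi)
        simpa [mul_comm] using this)
      refine ⟨Function.update l j (∑ i ∈ s, l i * f i x₀ - g x₀), fun i => ?_, fun x => ?_⟩
      · by_cases hi : i = j
        · subst hi
          have : 0 ≤ ∑ k ∈ s, l k * f k x₀ :=
            Finset.sum_nonneg fun k hk => mul_nonneg (hl k) (hx₀ k hk)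
          rw [Function.update_self]
          linarith
        · simpa [hi] using hl i
      · have h1 := hlg x
        have h2 : ∑ i ∈ s, Function.update l j (∑ i ∈ s, l i * f i x₀ - g x₀) i * f i x
            = ∑ i ∈ s, l i * f i x := by
          refine Finset.sum_congr rfl fun i hi => ?_
          rw [Function.update_of_ne (ne_of_mem_of_not_mem hi hj)]
        simp only [LinearMap.add_apply, LinearMap.smul_apply, smul_eq_mul, mul_add,
          Finset.sum_add_distrib, ← mul_assoc, ← Finset.sum_mul] at h1
        rw [Finset.sum_insert hj, Function.update_self, h2]
        linarith

/-- Attainment and strong duality for a feasible linear program with bounded objective. -/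
theorem exists_lp_optimal {E ι : Type*} [AddCommGroup E] [Module ℝ E] (s : Finset ι)
    (f : ι → E →ₗ[ℝ] ℝ) (b : ι → ℝ) (c : E →ₗ[ℝ] ℝ)
    (hfeas : ∃ x, ∀ i ∈ s, b i ≤ f i x) {L : ℝ}
    (hbdd : ∀ x, (∀ i ∈ s, b i ≤ f i x) → L ≤ c x) :
    ∃ (x : E) (l : ι → ℝ), (∀ i ∈ s, b i ≤ f i x) ∧ (∀ i, 0 ≤ l i) ∧
      (∀ y, c y = ∑ i ∈ s, l i * f i y) ∧ c x = ∑ i ∈ s, l i * b i := by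
  set V : Set ℝ := {r | ∃ x, (∀ i ∈ s, b i ≤ f i x) ∧ c x = r} with hV
  have hVne : V.Nonempty := let ⟨x, hx⟩ := hfeas; ⟨c x, x, hx, rfl⟩
  have hVbdd : BddBelow V := ⟨L, by rintro _ ⟨x, hx, rfl⟩; exact hbdd x hx⟩
  set v := sInf V
  have hv : ∀ x, (∀ i ∈ s, b i ≤ f i x) → v ≤ c x := fun x hx => csInf_le hVbdd ⟨x, hx, rfl⟩
  have hscale : ∀ (x : E) (t : ℝ), 0 < t → (∀ i ∈ s, 0 ≤ f i x - b i * t) →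
      ∀ i ∈ s, b i ≤ f i (t⁻¹ • x) := by
    intro x t ht hx i hi
    rw [map_smul, smul_eq_mul, inv_mul_eq_div, le_div_iff₀ ht]
    linarith [hx i hi]
  let F : ι → E × ℝ →ₗ[ℝ] ℝ := fun i => (f i).coprod ((-b i) • LinearMap.id)
  have hF : ∀ i p, F i p = f i p.1 - b i * p.2 := fun i p => by simp [F]; ring
  obtain ⟨x, hx, hcx⟩ : ∃ x, (∀ i ∈ s, b i ≤ f i x) ∧ c x ≤ v := by
    by_contra! hno
    obtain ⟨l, hl, hlg⟩ := farkas s.insertNone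
      (fun o => o.elim ((-c).coprod (v • LinearMap.id)) F) ((0 : E →ₗ[ℝ] ℝ).coprod (-LinearMap.id))
      (by
        rintro ⟨x, t⟩ hx
        by_contra! hn
        have ht : 0 < t := by simpa using hn
        have hx' : ∀ i ∈ s, b i ≤ f i (t⁻¹ • x) := hscale x t ht fun i hi => by
          simpa [hF] using hx (some i) (by simpa using hi)
        have h1 := hno _ hx'
        have h2 := hx none (by simp)
        rw [map_smul, smul_eq_mul, inv_mul_eq_div, lt_div_iff₀ ht] at h1
        simp at h2
        linarith)
    have hsum : ∀ x t, -t = l none * (v * t - c x) + ∑ i ∈ s, l (some i) * (f i x - b i * t) := by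
      intro x t
      have := hlg (x, t)
      rw [Finset.sum_insertNone] at this
      simp only [Option.elim_none, Option.elim_some, hF] at this
      simp only [LinearMap.coprod_apply, LinearMap.neg_apply, LinearMap.smul_apply,
        LinearMap.id_apply, smul_eq_mul, LinearMap.zero_apply, zero_add] at this
      rw [this]
      ring
    have hpos : 0 < (l none + 1)⁻¹ := inv_pos.2 (by linarith [hl none])
    obtain ⟨_, ⟨y, hy, rfl⟩, hlt⟩ := exists_lt_of_csInf_lt hVne
      (show v < v + (l none + 1)⁻¹ by linarith)
    have h1 := hsum y 1
    have h2 : 0 ≤ ∑ i ∈ s, l (some i) * (f i y - b i * 1) :=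
      Finset.sum_nonneg fun i hi => mul_nonneg (hl _) (by linarith [hy i hi])
    have h3 : l none * (c y - v) ≤ l none * (l none + 1)⁻¹ :=
      mul_le_mul_of_nonneg_left (by linarith) (hl none)
    have h4 : l none * (l none + 1)⁻¹ < 1 := by
      have := hl none
      rw [← div_eq_mul_inv, div_lt_one (by linarith)]
      linarith
    linarith
  obtain ⟨l, hl, hlg⟩ := farkas s.insertNone
    (fun o => o.elim (LinearMap.snd ℝ E ℝ) F) (c.coprod ((-v) • LinearMap.id))
    (by
      rintro ⟨y, t⟩ hy
      have ht : 0 ≤ t := by simpa using hy none (by simp)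
      have hy' : ∀ i ∈ s, 0 ≤ f i y - b i * t := fun i hi => by
        simpa [hF] using hy (some i) (by simpa using hi)
      rcases ht.eq_or_lt with rfl | ht
      · have := hv (x + y) fun i hi => by
          have h1 := hy' i hi
          have h2 := hx i hi
          rw [map_add]
          linarith
        rw [map_add] at this
        simp
        linarith
      · have := hv _ (hscale y t ht hy')
        rw [map_smul, smul_eq_mul, inv_mul_eq_div, le_div_iff₀ ht] at this
        simp
        linarith)
  have hsum : ∀ y t, c y - v * t = l none * t + ∑ i ∈ s, l (some i) * (f i y - b i * t) := by
    intro y t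
    have := hlg (y, t)
    rw [Finset.sum_insertNone] at this
    simp only [Option.elim_none, Option.elim_some, hF] at this
    simp only [LinearMap.coprod_apply, LinearMap.smul_apply,
      LinearMap.id_apply, smul_eq_mul, LinearMap.snd_apply] at this
    rw [← this]
    ring
  have hcl : ∀ y, c y = ∑ i ∈ s, l (some i) * f i y := fun y => by simpa using hsum y 0
  refine ⟨x, fun i => l (some i), hx, fun i => hl _, hcl, ?_⟩
  refine le_antisymm ?_ ?_
  · have := hsum 0 1
    simp only [map_zero, zero_sub, mul_one, mul_neg, Finset.sum_neg_distrib] at this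
    linarith [hl none]
  · rw [hcl x]
    exact Finset.sum_le_sum fun i hi => mul_le_mul_of_nonneg_left (hx i hi) (hl _)

/-! ### Atoms and elementary conditional expectation -/

/-- `f` is constant on the atoms of the σ-field `m`. -/
def AtomConst (m : MeasurableSpace Ω) (f : Ω → ℝ) : Prop :=
  ∀ ω ω', sameAtom m ω ω' → f ω = f ω'

section Atoms

variable {m : MeasurableSpace Ω} {ω ω' ω'' : Ω}

lemma sameAtom_refl : sameAtom m ω ω := fun _ _ => Iff.rfl

lemma sameAtom.symm (h : sameAtom m ω ω') : sameAtom m ω' ω := fun A hA => (h A hA).symm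

lemma sameAtom.trans (h : sameAtom m ω ω') (h' : sameAtom m ω' ω'') : sameAtom m ω ω'' :=
  fun A hA => (h A hA).trans (h' A hA)

lemma measurableSet_atom (m : MeasurableSpace Ω) (ω : Ω) :
    MeasurableSet[m] {ω' | sameAtom m ω ω'} := by
  have h : {ω' | sameAtom m ω ω'} = ⋂ A ∈ {A : Set Ω | MeasurableSet[m] A ∧ ω ∈ A}, A := by
    ext ω'
    simp only [Set.mem_ofPred_eq, Set.mem_iInter]
    refine ⟨fun h A hA => (h A hA.1).1 hA.2, fun h A hA => ?_⟩
    by_cases hω : ω ∈ A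
    · simp [hω, h A ⟨hA, hω⟩]
    · simpa [hω] using h Aᶜ ⟨hA.compl, hω⟩
  rw [h]
  exact MeasurableSet.biInter (Set.toFinite _).countable fun A hA => hA.1

lemma measurable_iff_atomConst {f : Ω → ℝ} : Measurable[m] f ↔ AtomConst m f := by
  constructor
  · intro hf ω ω' h
    exact ((h _ (hf (measurableSet_singleton (f ω)))).1 rfl).symm
  · intro hf B _
    have h : f ⁻¹' B = ⋃ ω ∈ f ⁻¹' B, {ω' | sameAtom m ω ω'} := by
      ext ω
      simp only [Set.mem_iUnion, Set.mem_ofPred_eq, exists_prop]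
      refine ⟨fun hω => ⟨ω, hω, sameAtom_refl⟩, ?_⟩
      rintro ⟨ω', hω', h⟩
      simpa [← hf _ _ h] using hω'
    rw [h]
    exact MeasurableSet.biUnion (Set.toFinite _).countable fun ω _ => measurableSet_atom m ω

lemma AtomConst.mono {m' : MeasurableSpace Ω} {f : Ω → ℝ} (hm : m ≤ m') (hf : AtomConst m f) :
    AtomConst m' f := fun ω ω' h => hf ω ω' fun A hA => h A (hm A hA)

lemma atomConst_condExp (m : MeasurableSpace Ω) (P f : Ω → ℝ) : AtomConst m (condExp m P f) := by
  intro ω ω' h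
  have : {ω'' | sameAtom m ω ω''} = {ω'' | sameAtom m ω' ω''} :=
    Set.ext fun ω'' => ⟨h.symm.trans, h.trans⟩
  simp only [condExp, this]

variable {P f g : Ω → ℝ}

lemma sum_mul_condExp (hP : ∀ ω, 0 ≤ P ω) (hg : AtomConst m g) :
    ∑ ω, P ω * (g ω * condExp m P f ω) = ∑ ω, P ω * (g ω * f ω) := by
  classical
  let n : Ω → ℝ := fun ω => ∑ ω', if sameAtom m ω ω' then P ω' else 0
  have hc : ∀ ω, condExp m P f ω = (∑ ω', if sameAtom m ω ω' then P ω' * f ω' else 0) / n ω := by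
    intro ω
    simp [condExp, n, Set.indicator_apply]
  have hn : AtomConst m n := by
    intro ω ω' h
    have : ∀ ω'', sameAtom m ω ω'' ↔ sameAtom m ω' ω'' := fun ω'' => ⟨h.symm.trans, h.trans⟩
    simp only [n, this]
  calc ∑ ω, P ω * (g ω * condExp m P f ω)
      = ∑ ω, ∑ ω', if sameAtom m ω ω' then P ω * g ω / n ω * (P ω' * f ω') else 0 := by
        refine Finset.sum_congr rfl fun ω _ => ?_
        rw [hc, ← mul_assoc, ← mul_div_assoc, mul_div_right_comm, Finset.mul_sum]
        simp only [mul_ite, mul_zero]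
    _ = ∑ ω', ∑ ω, if sameAtom m ω ω' then P ω * g ω / n ω * (P ω' * f ω') else 0 :=
        Finset.sum_comm
    _ = ∑ ω', ∑ ω, g ω' / n ω' * (P ω' * f ω') * if sameAtom m ω' ω then P ω else 0 := by
        refine Finset.sum_congr rfl fun ω' _ => Finset.sum_congr rfl fun ω _ => ?_
        by_cases h : sameAtom m ω ω'
        · rw [if_pos h, if_pos h.symm, hg _ _ h, hn _ _ h]
          ring
        · rw [if_neg h, if_neg (fun h' => h h'.symm), mul_zero]
    _ = ∑ ω', P ω' * (g ω' * f ω') := by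
        refine Finset.sum_congr rfl fun ω' _ => ?_
        rw [← Finset.mul_sum]
        change g ω' / n ω' * (P ω' * f ω') * n ω' = _
        by_cases h : n ω' = 0
        · have h0 := (Finset.sum_eq_zero_iff_of_nonneg (fun i _ => by
            split_ifs <;> simp [hP])).1 h ω' (Finset.mem_univ _)
          rw [if_pos sameAtom_refl] at h0
          simp [h0]
        · field_simp

lemma sum_indicator_atom_pos (hP : ∀ ω, 0 ≤ P ω) (hω : 0 < P ω) :
    0 < ∑ ω', Set.indicator {ω'' | sameAtom m ω ω''} P ω' := by
  refine Finset.sum_pos' (fun i _ => Set.indicator_nonneg (fun i _ => hP i) i)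
    ⟨ω, Finset.mem_univ _, ?_⟩
  rwa [Set.indicator_of_mem (show ω ∈ {ω'' | sameAtom m ω ω''} from sameAtom_refl)]

lemma condExp_of_atomConst (hP : ∀ ω, 0 ≤ P ω) (hω : 0 < P ω) (hg : AtomConst m g) :
    condExp m P g ω = g ω := by
  rw [condExp, div_eq_iff (sum_indicator_atom_pos hP hω).ne', Finset.mul_sum]
  refine Finset.sum_congr rfl fun ω' _ => ?_
  by_cases h : sameAtom m ω ω'
  · simp [h, hg _ _ h, mul_comm]
  · simp [h]

/-- Conditional expectations compare as soon as the integrals against nonnegative `m`-measurable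
functions do. -/
lemma condExp_le_condExp (hP : ∀ ω, 0 ≤ P ω) {f' : Ω → ℝ}
    (h : ∀ k, AtomConst m k → (∀ ω, 0 ≤ k ω) → ∑ ω, P ω * (k ω * f ω) ≤ ∑ ω, P ω * (k ω * f' ω)) :
    condExp m P f ω ≤ condExp m P f' ω := by
  classical
  have hk := h (Set.indicator {ω'' | sameAtom m ω ω''} 1) (by
      intro ω₁ ω₂ h₁₂
      have : sameAtom m ω ω₁ ↔ sameAtom m ω ω₂ := ⟨fun h => h.trans h₁₂, fun h => h.trans h₁₂.symm⟩
      simp [Set.indicator_apply, this])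
    fun ω' => Set.indicator_nonneg (fun _ _ => zero_le_one) ω'
  rw [condExp, condExp]
  refine div_le_div_of_nonneg_right ?_
    (Finset.sum_nonneg fun i _ => Set.indicator_nonneg (fun i _ => hP i) i)
  have hsum : ∀ φ : Ω → ℝ, ∑ ω', Set.indicator {ω'' | sameAtom m ω ω''} (fun i => P i * φ i) ω' =
      ∑ ω', P ω' * (Set.indicator {ω'' | sameAtom m ω ω''} 1 ω' * φ ω') := by
    intro φ
    refine Finset.sum_congr rfl fun ω' _ => ?_
    by_cases hω' : sameAtom m ω ω' <;> simp [hω']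
  rw [hsum, hsum]
  exact hk

end Atoms

/-! ### Weak duality -/

section WeakDuality

variable {M} {t : ℕ} {ω : Ω} {ξ ζ α β χ S : ℕ → Ω → ℝ} {P : Ω → ℝ}

lemma IsAdapted.atomConst {X : ℕ → Ω → ℝ} (hX : IsAdapted M X) (ht : t ≤ M.T) :
    AtomConst (M.F t) (X t) := measurable_iff_atomConst.1 (hX t ht)

lemma liq_nonneg_iff (ht : t ≤ M.T) {γ δ : ℝ} :
    0 ≤ liq M t ω γ δ ↔ 0 ≤ γ + M.Sb t ω * δ ∧ 0 ≤ γ + M.Sa t ω * δ := by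
  have h := M.Sb_le_Sa t ω ht
  rcases le_total 0 δ with hδ | hδ
  · have := mul_le_mul_of_nonneg_right h hδ
    rw [liq, max_eq_left hδ, max_eq_right (neg_nonpos.2 hδ), mul_zero, sub_zero]
    exact ⟨fun h' => ⟨h', by linarith⟩, And.left⟩
  · have := mul_le_mul_of_nonpos_right h hδ
    rw [liq, max_eq_right hδ, max_eq_left (neg_nonneg.2 hδ), mul_zero, add_zero, mul_neg,
      sub_neg_eq_add]
    exact ⟨fun h' => ⟨by linarith, h'⟩, And.right⟩

/-- A position with nonnegative liquidation value has nonnegative value at every price between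
bid and ask (in homogeneous form). -/
lemma nonneg_of_liq_nonneg (ht : t ≤ M.T) {γ δ c y : ℝ} (h : 0 ≤ liq M t ω γ δ) (hc : 0 ≤ c)
    (hb : c * M.Sb t ω ≤ y) (ha : y ≤ c * M.Sa t ω) : 0 ≤ c * γ + y * δ := by
  obtain ⟨h₁, h₂⟩ := (liq_nonneg_iff ht).1 h
  have h₁' := mul_nonneg hc h₁
  have h₂' := mul_nonneg hc h₂
  rcases le_total 0 δ with hδ | hδ
  · have := mul_le_mul_of_nonneg_right hb hδ
    linarith
  · have := mul_le_mul_of_nonpos_right ha hδ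
    linarith

lemma sum_Icc_eq_add_sum_Icc_succ {T : ℕ} (ht : t ≤ T) (f : ℕ → ℝ) :
    ∑ s ∈ Finset.Icc t T, f s = f t + ∑ s ∈ Finset.Icc (t + 1) T, f s := by
  rw [← Finset.add_sum_Ioc_eq_sum_Icc ht, ← Finset.Icc_succ_left_eq_Ioc]
  rfl

lemma chiStar_eq_add (ht : t ≤ M.T) : chiStar M χ t ω = χ t ω + chiStar M χ (t + 1) ω :=
  sum_Icc_eq_add_sum_Icc_succ ht _

lemma starVal_eq_add (ht : t ≤ M.T) :
    starVal M χ S t ω = χ t ω * S t ω + starVal M χ S (t + 1) ω :=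
  sum_Icc_eq_add_sum_Icc_succ ht _

lemma chiStar_succ_horizon : chiStar M χ (M.T + 1) ω = 0 := by simp [chiStar]

lemma starVal_succ_horizon : starVal M χ S (M.T + 1) ω = 0 := by simp [starVal]

lemma IsMixedStop.chiStar_zero (hχ : IsMixedStop M χ) : chiStar M χ 0 ω = 1 := by
  rw [← hχ.2.2 ω, chiStar, Finset.range_eq_Ico]
  rfl

lemma IsMixedStop.chiStar_nonneg (hχ : IsMixedStop M χ) : 0 ≤ chiStar M χ t ω :=
  Finset.sum_nonneg fun _ _ => hχ.2.1 _ _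

lemma SelfFinancing.atomConst (h : SelfFinancing M α β) (ht : t ≤ M.T) :
    AtomConst (M.F t) (α t) ∧ AtomConst (M.F t) (β t) := by
  obtain ⟨h₁, h₂, h₃, -⟩ := h
  cases t with
  | zero => exact ⟨measurable_iff_atomConst.1 h₁, measurable_iff_atomConst.1 h₂⟩
  | succ t =>
    have hm := M.F_mono t.le_succ
    exact ⟨(measurable_iff_atomConst.1 (h₃ t ht).1).mono hm,
      (measurable_iff_atomConst.1 (h₃ t ht).2).mono hm⟩

lemma SellerHedge.payoff (h : SellerHedge M ξ ζ α β) (ht : t ≤ M.T) (ω : Ω) :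
    0 ≤ liq M t ω (α t ω - ξ t ω) (β t ω - ζ t ω) :=
  h.2 (fun _ => t) ⟨fun _ => ht, fun _ => MeasurableSet.const _⟩ ω

lemma memBarP.sum_nonneg_of_liq (hP : memBarP M χ P S) (hχ : IsMixedStop M χ) (ht : t ≤ M.T)
    {γ δ : Ω → ℝ} (hδ : AtomConst (M.F t) δ) (h : ∀ ω, 0 ≤ liq M t ω (γ ω) (δ ω)) :
    0 ≤ ∑ ω, P ω * (chiStar M χ (t + 1) ω * γ ω + δ ω * starVal M χ S (t + 1) ω) := by
  have hswap := sum_mul_condExp (f := starVal M χ S (t + 1)) hP.1 hδ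
  simp only [mul_add, Finset.sum_add_distrib] at hswap ⊢
  rw [← hswap, ← Finset.sum_add_distrib]
  refine Finset.sum_nonneg fun ω _ => ?_
  rw [← mul_add]
  rcases (hP.1 ω).eq_or_lt with h0 | hpos
  · rw [← h0, zero_mul]
  · obtain ⟨hb, ha⟩ := hP.2.2.2.2 t ht ω hpos
    rw [mul_comm (δ ω)]
    exact mul_nonneg hpos.le (nonneg_of_liq_nonneg ht (h ω) hχ.chiStar_nonneg hb ha)

lemma memBarP.sum_stopped_nonneg_of_liq (hP : memBarP M χ P S) (hχ : IsMixedStop M χ)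
    (ht : t ≤ M.T) {γ δ : Ω → ℝ} (h : ∀ ω, 0 ≤ liq M t ω (γ ω) (δ ω)) :
    0 ≤ ∑ ω, P ω * (χ t ω * (γ ω + S t ω * δ ω)) := by
  refine Finset.sum_nonneg fun ω _ => mul_nonneg (hP.1 ω) ?_
  obtain ⟨hb, ha⟩ := hP.2.2.2.1 t ω ht
  have hχt := hχ.2.1 t ω
  have := nonneg_of_liq_nonneg ht (h ω) hχt (mul_le_mul_of_nonneg_left hb hχt)
    (mul_le_mul_of_nonneg_left ha hχt)
  linarith

theorem expect_le_cost (hP : memBarP M χ P S) (hχ : IsMixedStop M χ)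
    (h : SellerHedge M ξ ζ α β) {x : ℝ} (hx : ∀ ω, 0 ≤ liq M 0 ω (x - α 0 ω) (-β 0 ω)) :
    expect P (mixVal M χ fun t ω => ξ t ω + S t ω * ζ t ω) ≤ x := by
  set W : ℕ → ℝ := fun t => ∑ ω, P ω * (chiStar M χ t ω * α t ω + β t ω * starVal M χ S t ω)
    with hW
  set X : ℕ → ℝ := fun t => ∑ ω, P ω * (χ t ω * (ξ t ω + S t ω * ζ t ω)) with hX
  have hstep : ∀ t < M.T, X t ≤ W t - W (t + 1) := by
    intro t ht
    have hδ : AtomConst (M.F t) fun ω => β t ω - β (t + 1) ω := fun ω ω' hω => by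
      dsimp only
      rw [(h.1.atomConst ht.le).2 ω ω' hω, measurable_iff_atomConst.1 (h.1.2.2.1 t ht).2 ω ω' hω]
    have h₁ := hP.sum_nonneg_of_liq hχ ht.le hδ (h.1.2.2.2 t ht)
    have h₂ := hP.sum_stopped_nonneg_of_liq hχ ht.le (h.payoff ht.le)
    have h₃ := add_nonneg h₁ h₂
    rw [← Finset.sum_add_distrib] at h₃
    refine sub_nonneg.1 (h₃.trans_eq ?_)
    simp only [hW, hX, ← Finset.sum_sub_distrib]
    refine Finset.sum_congr rfl fun ω _ => ?_
    rw [chiStar_eq_add ht.le, starVal_eq_add ht.le]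
    ring
  have hlast : X M.T ≤ W M.T := by
    have h₂ := hP.sum_stopped_nonneg_of_liq hχ le_rfl (h.payoff le_rfl)
    refine sub_nonneg.1 (h₂.trans_eq ?_)
    simp only [hW, hX, ← Finset.sum_sub_distrib]
    refine Finset.sum_congr rfl fun ω _ => ?_
    rw [chiStar_eq_add le_rfl, starVal_eq_add le_rfl, chiStar_succ_horizon, starVal_succ_horizon]
    ring
  have hfirst : W 0 ≤ x := by
    have hδ : AtomConst (M.F 0) fun ω => -β 0 ω := fun ω ω' hω => by
      dsimp only
      rw [(h.1.atomConst (Nat.zero_le _)).2 ω ω' hω]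
    have h₁ := hP.sum_nonneg_of_liq hχ (Nat.zero_le _) hδ hx
    have h₂ := hP.sum_stopped_nonneg_of_liq hχ (Nat.zero_le _) hx
    have h₃ := add_nonneg h₁ h₂
    rw [← Finset.sum_add_distrib] at h₃
    have hxP : x = ∑ ω, P ω * x := by rw [← Finset.sum_mul, hP.2.1, one_mul]
    refine sub_nonneg.1 (h₃.trans_eq ?_)
    rw [hxP, hW, ← Finset.sum_sub_distrib, ← hxP]
    refine Finset.sum_congr rfl fun ω _ => ?_
    have hc := hχ.chiStar_zero (ω := ω)
    rw [hc, starVal_eq_add (Nat.zero_le _)]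
    rw [chiStar_eq_add (Nat.zero_le _)] at hc
    linear_combination (P ω * (x - α 0 ω)) * hc
  have hsum : expect P (mixVal M χ fun t ω => ξ t ω + S t ω * ζ t ω) =
      ∑ t ∈ Finset.range (M.T + 1), X t := by
    simp only [expect, mixVal, hX, Finset.mul_sum]
    exact Finset.sum_comm
  have htel : ∑ t ∈ Finset.range M.T, X t ≤ W 0 - W M.T := by
    rw [← Finset.sum_range_sub']
    exact Finset.sum_le_sum fun t ht => hstep t (Finset.mem_range.1 ht)
  rw [hsum, Finset.sum_range_succ]
  linarith

end WeakDuality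

/-! ### A dual element from absence of arbitrage -/

lemma ArbitrageFree.exists_memBarP {M : Market Ω} (h : ArbitrageFree M) :
    ∃ χ P S, IsMixedStop M χ ∧ memBarP M χ P S := by
  obtain ⟨P, S, hPpos, hP1, hS, hSb, hmart⟩ := h
  have hP : ∀ ω, 0 ≤ P ω := fun ω => (hPpos ω).le
  have htower : ∀ t g, AtomConst (M.F t) g → ∀ n, t ≤ n → n ≤ M.T →
      ∑ ω, P ω * (g ω * S n ω) = ∑ ω, P ω * (g ω * S t ω) := by
    intro t g hg n htn
    induction n, htn using Nat.le_induction with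
    | base => exact fun _ => rfl
    | succ n htn ih =>
      intro hn
      rw [← ih (by omega), ← sum_mul_condExp hP (hg.mono (M.F_mono htn))]
      exact Finset.sum_congr rfl fun ω _ => by rw [hmart n hn ω (hPpos ω)]
  have hmartT : ∀ t ≤ M.T, ∀ ω, condExp (M.F t) P (S M.T) ω = S t ω := by
    intro t ht ω
    rw [← condExp_of_atomConst hP (hPpos ω) (hS.atomConst ht)]
    exact le_antisymm
      (condExp_le_condExp hP fun k hk _ => (htower t k hk _ ht le_rfl).le)
      (condExp_le_condExp hP fun k hk _ => (htower t k hk _ ht le_rfl).ge)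
  refine ⟨pureChi fun _ => M.T, P, S, ⟨fun t _ => ?_, fun t ω => ?_, fun ω => ?_⟩,
    hP, hP1, hS, hSb, fun t ht ω hω => ?_⟩
  · exact measurable_const
  · unfold pureChi
    split_ifs <;> norm_num
  · simp [pureChi]
  · rcases ht.lt_or_eq with ht' | rfl
    · have hc : chiStar M (pureChi fun _ => M.T) (t + 1) ω = 1 := by
        simp [chiStar, pureChi, Nat.succ_le_of_lt ht']
      have hv : starVal M (pureChi fun _ => M.T) S (t + 1) = S M.T := by
        ext ω
        simp [starVal, pureChi, Nat.succ_le_of_lt ht']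
      rw [hc, hv, hmartT t ht, one_mul, one_mul]
      exact hSb t ω ht
    · have hv : starVal M (pureChi fun _ => M.T) S (M.T + 1) = 0 := by
        ext ω
        exact starVal_succ_horizon
      rw [chiStar_succ_horizon, hv]
      simp [condExp]

/-! ### From multipliers to mixed stopping times and approximate martingales -/

lemma condExp_const_mul {m : MeasurableSpace Ω} {P f g : Ω → ℝ} (hg : AtomConst m g) (ω : Ω) :
    condExp m P (fun ω => g ω * f ω) ω = g ω * condExp m P f ω := by
  simp only [condExp]
  rw [← mul_div_assoc, Finset.mul_sum]
  congr 1
  refine Finset.sum_congr rfl fun ω' _ => ?_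
  by_cases h : sameAtom m ω ω'
  · simp only [Set.mem_ofPred_eq, h, Set.indicator_of_mem, hg _ _ h]
    ring
  · simp [h]

/-- Multipliers of the seller's superhedging problem: `a`, `b` are the masses stopped at, and
continuing after, each time; `A`, `B` are the corresponding masses weighted by stock prices. -/
structure DualWeights (M : Market Ω) (a A b B : ℕ → Ω → ℝ) : Prop where
  a_nonneg : ∀ t ω, 0 ≤ a t ω
  b_nonneg : ∀ t ω, 0 ≤ b t ω
  b_horizon : b M.T = 0
  B_horizon : B M.T = 0
  A_mem : ∀ t ≤ M.T, ∀ ω, a t ω * M.Sb t ω ≤ A t ω ∧ A t ω ≤ a t ω * M.Sa t ω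
  B_mem : ∀ t ≤ M.T, ∀ ω, b t ω * M.Sb t ω ≤ B t ω ∧ B t ω ≤ b t ω * M.Sa t ω
  sum_zero : ∑ ω, (a 0 ω + b 0 ω) = 1
  flow : ∀ t < M.T, ∀ g, AtomConst (M.F t) g →
    ∑ ω, g ω * b t ω = ∑ ω, g ω * (a (t + 1) ω + b (t + 1) ω)
  flow' : ∀ t < M.T, ∀ g, AtomConst (M.F t) g →
    ∑ ω, g ω * B t ω = ∑ ω, g ω * (A (t + 1) ω + B (t + 1) ω)

/-- Averaging of a process over the atoms of the filtration. -/
def atomAverage (M : Market Ω) (X : ℕ → Ω → ℝ) (t : ℕ) : Ω → ℝ := condExp (M.F t) 1 (X t)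

section DualWeights

variable {M} {a A b B : ℕ → Ω → ℝ}

lemma atomConst_atomAverage (X : ℕ → Ω → ℝ) (t : ℕ) : AtomConst (M.F t) (atomAverage M X t) :=
  atomConst_condExp _ _ _

lemma sum_mul_atomAverage (X : ℕ → Ω → ℝ) {t : ℕ} {g : Ω → ℝ} (hg : AtomConst (M.F t) g) :
    ∑ ω, g ω * atomAverage M X t ω = ∑ ω, g ω * X t ω := by
  simpa [atomAverage] using sum_mul_condExp (P := 1) (f := X t) (fun _ => zero_le_one) hg

lemma atomAverage_le {X Y : ℕ → Ω → ℝ} {t : ℕ} (h : ∀ ω, X t ω ≤ Y t ω) (ω : Ω) :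
    atomAverage M X t ω ≤ atomAverage M Y t ω :=
  condExp_le_condExp (fun _ => zero_le_one) fun k _ hk =>
    Finset.sum_le_sum fun ω _ => by simpa using mul_le_mul_of_nonneg_left (h ω) (hk ω)

lemma atomAverage_of_eq_zero {X : ℕ → Ω → ℝ} {t : ℕ} (h : X t = 0) : atomAverage M X t = 0 := by
  ext ω
  simp [atomAverage, condExp, h]

lemma atomAverage_mul {X Y : ℕ → Ω → ℝ} {t : ℕ} (hY : AtomConst (M.F t) (Y t)) (ω : Ω) :
    atomAverage M (fun t ω => X t ω * Y t ω) t ω = atomAverage M X t ω * Y t ω := by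
  rw [mul_comm, atomAverage, atomAverage, ← condExp_const_mul hY]
  simp only [mul_comm]

lemma atomAverage_nonneg {X : ℕ → Ω → ℝ} (h : ∀ t ω, 0 ≤ X t ω) (t : ℕ) (ω : Ω) :
    0 ≤ atomAverage M X t ω := by
  have h0 : atomAverage M (0 : ℕ → Ω → ℝ) t ω = 0 := by rw [atomAverage_of_eq_zero rfl]; rfl
  rw [← h0]
  exact atomAverage_le (fun ω => h t ω) ω

lemma atomAverage_mem {X Y : ℕ → Ω → ℝ}
    (h : ∀ t ≤ M.T, ∀ ω, X t ω * M.Sb t ω ≤ Y t ω ∧ Y t ω ≤ X t ω * M.Sa t ω) (t : ℕ)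
    (ht : t ≤ M.T) (ω : Ω) :
    atomAverage M X t ω * M.Sb t ω ≤ atomAverage M Y t ω ∧
      atomAverage M Y t ω ≤ atomAverage M X t ω * M.Sa t ω := by
  rw [← atomAverage_mul (IsAdapted.atomConst M.Sb_adapted ht),
    ← atomAverage_mul (IsAdapted.atomConst M.Sa_adapted ht)]
  exact ⟨atomAverage_le (fun ω => (h t ht ω).1) ω, atomAverage_le (fun ω => (h t ht ω).2) ω⟩

lemma DualWeights.atomAverage (h : DualWeights M a A b B) :
    DualWeights M (atomAverage M a) (atomAverage M A) (atomAverage M b) (atomAverage M B) where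
  a_nonneg := atomAverage_nonneg h.a_nonneg
  b_nonneg := atomAverage_nonneg h.b_nonneg
  b_horizon := atomAverage_of_eq_zero h.b_horizon
  B_horizon := atomAverage_of_eq_zero h.B_horizon
  A_mem := atomAverage_mem h.A_mem
  B_mem := atomAverage_mem h.B_mem
  sum_zero := by
    have h1 : AtomConst (M.F 0) (1 : Ω → ℝ) := fun _ _ _ => rfl
    have ha := sum_mul_atomAverage a h1
    have hb := sum_mul_atomAverage b h1
    simp only [Pi.one_apply, one_mul] at ha hb
    rw [← h.sum_zero, Finset.sum_add_distrib, ha, hb, Finset.sum_add_distrib]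
  flow t ht g hg := by
    have hg' := hg.mono (M.F_mono t.le_succ)
    simp only [mul_add, Finset.sum_add_distrib]
    rw [sum_mul_atomAverage b hg, sum_mul_atomAverage a hg', sum_mul_atomAverage b hg',
      h.flow t ht g hg]
    simp only [mul_add, Finset.sum_add_distrib]
  flow' t ht g hg := by
    have hg' := hg.mono (M.F_mono t.le_succ)
    simp only [mul_add, Finset.sum_add_distrib]
    rw [sum_mul_atomAverage B hg, sum_mul_atomAverage A hg', sum_mul_atomAverage B hg',
      h.flow' t ht g hg]
    simp only [mul_add, Finset.sum_add_distrib]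

/-- The density process of the probability measure carried by the masses `a`, `b`. -/
def density (a b : ℕ → Ω → ℝ) : ℕ → Ω → ℝ
  | 0 => fun ω => a 0 ω + b 0 ω
  | t + 1 => fun ω => if b t ω = 0 then density a b t ω else
      density a b t ω / b t ω * (a (t + 1) ω + b (t + 1) ω)

/-- The proportion not yet stopped before each time. -/
def survival (a b : ℕ → Ω → ℝ) : ℕ → Ω → ℝ
  | 0 => fun _ => 1
  | t + 1 => fun ω => survival a b t ω * (b t ω / (a t ω + b t ω))

lemma density_succ (t : ℕ) (ω : Ω) : density a b (t + 1) ω = if b t ω = 0 then density a b t ω else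
    density a b t ω / b t ω * (a (t + 1) ω + b (t + 1) ω) := rfl

lemma survival_succ (t : ℕ) (ω : Ω) :
    survival a b (t + 1) ω = survival a b t ω * (b t ω / (a t ω + b t ω)) := rfl

lemma DualWeights.density_nonneg (h : DualWeights M a A b B) (t : ℕ) (ω : Ω) :
    0 ≤ density a b t ω := by
  induction t with
  | zero => exact add_nonneg (h.a_nonneg _ _) (h.b_nonneg _ _)
  | succ t ih =>
    rw [density_succ]
    split_ifs
    · exact ih
    · exact mul_nonneg (div_nonneg ih (h.b_nonneg _ _))
        (add_nonneg (h.a_nonneg _ _) (h.b_nonneg _ _))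

lemma DualWeights.survival_nonneg (h : DualWeights M a A b B) (t : ℕ) (ω : Ω) :
    0 ≤ survival a b t ω := by
  induction t with
  | zero => exact zero_le_one
  | succ t ih =>
    exact mul_nonneg ih (div_nonneg (h.b_nonneg _ _) (add_nonneg (h.a_nonneg _ _) (h.b_nonneg _ _)))

lemma DualWeights.survival_succ_le (h : DualWeights M a A b B) (t : ℕ) (ω : Ω) :
    survival a b (t + 1) ω ≤ survival a b t ω := by
  refine mul_le_of_le_one_right (h.survival_nonneg t ω) (div_le_one_of_le₀ ?_ ?_)
  · linarith [h.a_nonneg t ω]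
  · exact add_nonneg (h.a_nonneg _ _) (h.b_nonneg _ _)

lemma survival_succ_atomConst (ha : ∀ t ≤ M.T, AtomConst (M.F t) (a t))
    (hb : ∀ t ≤ M.T, AtomConst (M.F t) (b t)) {t : ℕ} (ht : t ≤ M.T) :
    AtomConst (M.F t) (survival a b (t + 1)) := by
  induction t with
  | zero =>
    intro ω ω' hω
    simp only [survival, ha 0 ht ω ω' hω, hb 0 ht ω ω' hω]
  | succ t ih =>
    intro ω ω' hω
    have := (ih (by omega)).mono (M.F_mono t.le_succ) ω ω' hω
    rw [survival_succ, survival_succ _ ω', this, ha _ ht ω ω' hω, hb _ ht ω ω' hω]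

lemma survival_atomConst (ha : ∀ t ≤ M.T, AtomConst (M.F t) (a t))
    (hb : ∀ t ≤ M.T, AtomConst (M.F t) (b t)) {t : ℕ} (ht : t ≤ M.T) :
    AtomConst (M.F t) (survival a b t) := by
  cases t with
  | zero => exact fun _ _ _ => rfl
  | succ t => exact (survival_succ_atomConst ha hb (by omega)).mono (M.F_mono t.le_succ)

lemma density_atomConst (ha : ∀ t ≤ M.T, AtomConst (M.F t) (a t))
    (hb : ∀ t ≤ M.T, AtomConst (M.F t) (b t)) {t : ℕ} (ht : t ≤ M.T) :
    AtomConst (M.F t) (density a b t) := by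
  induction t with
  | zero =>
    intro ω ω' hω
    simp only [density, ha 0 ht ω ω' hω, hb 0 ht ω ω' hω]
  | succ t ih =>
    intro ω ω' hω
    have hm := M.F_mono t.le_succ
    have h₁ := (ih (by omega)).mono hm ω ω' hω
    have h₂ := (hb t (by omega)).mono hm ω ω' hω
    simp only [density, h₁, h₂, ha _ ht ω ω' hω, hb _ ht ω ω' hω]

lemma DualWeights.mass_succ_eq_zero (h : DualWeights M a A b B)
    (hb : ∀ t ≤ M.T, AtomConst (M.F t) (b t)) {t : ℕ} (ht : t < M.T) {ω : Ω} (h0 : b t ω = 0) :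
    a (t + 1) ω + b (t + 1) ω = 0 := by
  have hflow := h.flow t ht (fun ω => if b t ω = 0 then 1 else 0) fun ω ω' hω => by
    simp only [hb t ht.le ω ω' hω]
  have hz : ∑ ω, (if b t ω = 0 then (1 : ℝ) else 0) * b t ω = 0 :=
    Finset.sum_eq_zero fun ω _ => by split_ifs with h <;> simp [h]
  rw [hz] at hflow
  have := (Finset.sum_eq_zero_iff_of_nonneg fun ω _ => mul_nonneg (by split_ifs <;> norm_num)
    (add_nonneg (h.a_nonneg _ _) (h.b_nonneg _ _))).1 hflow.symm ω (Finset.mem_univ ω)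
  simpa [h0] using this

lemma DualWeights.density_mul_survival_succ_of (h : DualWeights M a A b B) {t : ℕ} {ω : Ω}
    (hm : density a b t ω * survival a b t ω = a t ω + b t ω) :
    density a b t ω * survival a b (t + 1) ω = b t ω := by
  rw [survival_succ, ← mul_assoc, hm]
  by_cases h0 : a t ω + b t ω = 0
  · have := h.a_nonneg t ω
    have := h.b_nonneg t ω
    rw [h0, zero_mul]
    linarith
  · exact mul_div_cancel₀ _ h0

lemma DualWeights.density_mul_survival (h : DualWeights M a A b B)
    (hb : ∀ t ≤ M.T, AtomConst (M.F t) (b t)) {t : ℕ} (ht : t ≤ M.T) (ω : Ω) :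
    density a b t ω * survival a b t ω = a t ω + b t ω := by
  induction t with
  | zero => simp [density, survival]
  | succ t ih =>
    have ih := h.density_mul_survival_succ_of (ih (by omega))
    rw [density_succ]
    split_ifs with h0
    · rw [ih, h.mass_succ_eq_zero hb ht h0, h0]
    · rw [div_mul_eq_mul_div, div_mul_eq_mul_div, div_eq_iff h0, mul_right_comm, ih, mul_comm]

lemma DualWeights.sum_mul_density (h : DualWeights M a A b B)
    (ha : ∀ t ≤ M.T, AtomConst (M.F t) (a t)) (hb : ∀ t ≤ M.T, AtomConst (M.F t) (b t))
    {t n : ℕ} (htn : t ≤ n) (hn : n ≤ M.T) {g : Ω → ℝ} (hg : AtomConst (M.F t) g) :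
    ∑ ω, g ω * density a b n ω = ∑ ω, g ω * density a b t ω := by
  induction n, htn using Nat.le_induction with
  | base => rfl
  | succ n htn ih =>
    have hg' := hg.mono (M.F_mono htn)
    rw [← ih (by omega)]
    have hflow := h.flow n hn (fun ω => g ω * (density a b n ω / b n ω)) fun ω ω' hω => by
      dsimp only
      rw [hg' ω ω' hω, density_atomConst ha hb (by omega) ω ω' hω, hb n (by omega) ω ω' hω]
    calc ∑ ω, g ω * density a b (n + 1) ω
        = ∑ ω, (g ω * (density a b n ω / b n ω) * (a (n + 1) ω + b (n + 1) ω) +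
            if b n ω = 0 then g ω * density a b n ω else 0) := by
          refine Finset.sum_congr rfl fun ω _ => ?_
          rw [density_succ]
          split_ifs with h0
          · simp [h0]
          · ring
      _ = ∑ ω, (g ω * (density a b n ω / b n ω) * b n ω +
            if b n ω = 0 then g ω * density a b n ω else 0) := by
          rw [Finset.sum_add_distrib, ← hflow, ← Finset.sum_add_distrib]
      _ = ∑ ω, g ω * density a b n ω := by
          refine Finset.sum_congr rfl fun ω _ => ?_
          split_ifs with h0
          · simp [h0]
          · field_simp
            ring

/-- The multipliers give a mixed stopping time and an approximate martingale. -/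
theorem DualWeights.exists_memBarP (h : DualWeights M a A b B)
    (ha : ∀ t ≤ M.T, AtomConst (M.F t) (a t)) (hb : ∀ t ≤ M.T, AtomConst (M.F t) (b t))
    (hA : ∀ t ≤ M.T, AtomConst (M.F t) (A t)) :
    ∃ χ P S, IsMixedStop M χ ∧ memBarP M χ P S ∧ ∀ ξ ζ, AdaptedPair M ξ ζ →
      expect P (mixVal M χ fun t ω => ξ t ω + S t ω * ζ t ω) =
        ∑ t ∈ Finset.range (M.T + 1), ∑ ω, (a t ω * ξ t ω + A t ω * ζ t ω) := by
  set c := survival a b with hc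
  set D := density a b with hD
  set χ : ℕ → Ω → ℝ := fun t ω => c t ω - c (t + 1) ω with hχ
  set S : ℕ → Ω → ℝ := fun t ω => if a t ω = 0 then M.Sb t ω else A t ω / a t ω with hS
  have hD0 : ∀ ω, 0 ≤ D M.T ω := h.density_nonneg M.T
  have hcT : ∀ ω, c (M.T + 1) ω = 0 := fun ω => by simp [hc, survival, h.b_horizon]
  have hchi : ∀ t ≤ M.T + 1, ∀ ω, chiStar M χ t ω = c t ω := fun t ht ω => by
    refine Nat.decreasingInduction' (fun t htT _ ih => ?_) ht ?_
    · rw [chiStar_eq_add (Nat.le_of_lt_succ htT), ih, hχ, sub_add_cancel]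
    · rw [chiStar_succ_horizon, hcT]
  have hDc : ∀ t ≤ M.T, ∀ ω, D t ω * c (t + 1) ω = b t ω := fun t ht ω =>
    h.density_mul_survival_succ_of (h.density_mul_survival hb ht ω)
  have hDχ : ∀ t ≤ M.T, ∀ ω, D t ω * χ t ω = a t ω := fun t ht ω => by
    have := h.density_mul_survival hb ht ω
    rw [hχ, mul_sub, hDc t ht, this, add_sub_cancel_right]
  have haS : ∀ t ≤ M.T, ∀ ω, a t ω * S t ω = A t ω := by
    intro t ht ω
    rw [hS]
    dsimp only
    split_ifs with h0
    · have := h.A_mem t ht ω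
      rw [h0, zero_mul, zero_mul] at this
      rw [h0, zero_mul]
      exact le_antisymm this.1 this.2
    · exact mul_div_cancel₀ _ h0
  have hχconst : ∀ t ≤ M.T, AtomConst (M.F t) (χ t) := fun t ht ω ω' hω => by
    simp only [hχ, hc]
    rw [survival_atomConst ha hb ht ω ω' hω, survival_succ_atomConst ha hb ht ω ω' hω]
  have hSconst : ∀ t ≤ M.T, AtomConst (M.F t) (S t) := fun t ht ω ω' hω => by
    simp only [hS, ha t ht ω ω' hω, hA t ht ω ω' hω,
      IsAdapted.atomConst M.Sb_adapted ht ω ω' hω]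
  have hsumχ : ∀ t ≤ M.T, ∀ g, AtomConst (M.F t) g →
      ∑ ω, D M.T ω * (g ω * χ t ω) = ∑ ω, g ω * a t ω := by
    intro t ht g hg
    have := h.sum_mul_density ha hb ht le_rfl (g := fun ω => g ω * χ t ω) fun ω ω' hω => by
      dsimp only
      rw [hg ω ω' hω, hχconst t ht ω ω' hω]
    simp only [mul_comm (D M.T _)]
    rw [this]
    refine Finset.sum_congr rfl fun ω _ => ?_
    rw [← hDχ t ht ω]
    ring
  have hsumχS : ∀ t ≤ M.T, ∀ g, AtomConst (M.F t) g →
      ∑ ω, D M.T ω * (g ω * (χ t ω * S t ω)) = ∑ ω, g ω * A t ω := by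
    intro t ht g hg
    have := hsumχ t ht (fun ω => g ω * S t ω) fun ω ω' hω => by
      dsimp only
      rw [hg ω ω' hω, hSconst t ht ω ω' hω]
    refine Eq.trans (Finset.sum_congr rfl fun ω _ => by ring) (this.trans ?_)
    refine Finset.sum_congr rfl fun ω _ => ?_
    rw [← haS t ht ω]
    ring
  have hsumc : ∀ t ≤ M.T, ∀ g, AtomConst (M.F t) g →
      ∑ ω, D M.T ω * (g ω * c (t + 1) ω) = ∑ ω, g ω * b t ω := by
    intro t ht g hg
    have := h.sum_mul_density ha hb ht le_rfl (g := fun ω => g ω * c (t + 1) ω) fun ω ω' hω => by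
      simp only [hc]
      rw [hg ω ω' hω, survival_succ_atomConst ha hb ht ω ω' hω]
    simp only [mul_comm (D M.T _)]
    rw [this]
    refine Finset.sum_congr rfl fun ω _ => ?_
    rw [← hDc t ht ω]
    ring
  have hsumStar : ∀ t ≤ M.T, ∀ g, AtomConst (M.F t) g →
      ∑ ω, D M.T ω * (g ω * starVal M χ S (t + 1) ω) = ∑ ω, g ω * B t ω := by
    intro t ht
    refine Nat.decreasingInduction' (fun t htT _ ih g hg => ?_) ht fun g _ => ?_
    · have hg' := hg.mono (M.F_mono t.le_succ)
      rw [h.flow' t htT g hg]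
      simp only [mul_add, Finset.sum_add_distrib]
      rw [← ih g hg', ← hsumχS (t + 1) htT g hg', ← Finset.sum_add_distrib]
      refine Finset.sum_congr rfl fun ω _ => ?_
      rw [starVal_eq_add htT]
      ring
    · simp [starVal_succ_horizon, h.B_horizon]
  refine ⟨χ, D M.T, S, ⟨fun t ht => measurable_iff_atomConst.2 (hχconst t ht),
    fun t ω => sub_nonneg.2 (h.survival_succ_le t ω), fun ω => ?_⟩,
    ⟨hD0, ?_, fun t ht => measurable_iff_atomConst.2 (hSconst t ht), fun t ω ht => ?_,
      fun t ht ω hω => ?_⟩, fun ξ ζ hpay => ?_⟩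
  · rw [Finset.sum_range_sub' (fun t => c t ω), hcT, sub_zero]
    rfl
  · have := h.sum_mul_density ha hb (Nat.zero_le _) le_rfl (g := 1) fun _ _ _ => rfl
    simpa [density, h.sum_zero] using this
  · have hle := M.Sb_le_Sa t ω ht
    have hAm := h.A_mem t ht ω
    rw [hS]
    dsimp only
    split_ifs with h0
    · exact ⟨le_rfl, hle⟩
    · have hpos := (h.a_nonneg t ω).lt_of_ne' h0
      rw [le_div_iff₀ hpos, div_le_iff₀ hpos, mul_comm, mul_comm (M.Sa t ω)]
      exact hAm
  · have hcb : ∀ X : ℕ → Ω → ℝ, IsAdapted M X →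
        chiStar M χ (t + 1) ω * X t ω = condExp (M.F t) (D M.T) (fun ω => c (t + 1) ω * X t ω) ω :=
      fun X hX => by
        rw [hchi _ (by omega), condExp_of_atomConst hD0 hω]
        intro ω ω' hω
        simp only [hc]
        rw [survival_succ_atomConst ha hb ht ω ω' hω, hX.atomConst ht ω ω' hω]
    have hX : ∀ X : ℕ → Ω → ℝ, IsAdapted M X → ∀ k, AtomConst (M.F t) k →
        ∑ ω, D M.T ω * (k ω * (c (t + 1) ω * X t ω)) = ∑ ω, k ω * (b t ω * X t ω) := by
      intro X hX k hk
      have := hsumc t ht (fun ω => k ω * X t ω) fun ω ω' hω => by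
        dsimp only
        rw [hk ω ω' hω, hX.atomConst ht ω ω' hω]
      refine Eq.trans (Finset.sum_congr rfl fun ω _ => by ring) (this.trans ?_)
      exact Finset.sum_congr rfl fun ω _ => by ring
    rw [hcb _ M.Sb_adapted, hcb _ M.Sa_adapted]
    constructor <;> refine condExp_le_condExp hD0 fun k hk hk0 => ?_
    · rw [hX _ M.Sb_adapted k hk, hsumStar t ht k hk]
      exact Finset.sum_le_sum fun ω _ => mul_le_mul_of_nonneg_left (h.B_mem t ht ω).1 (hk0 ω)
    · rw [hX _ M.Sa_adapted k hk, hsumStar t ht k hk]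
      exact Finset.sum_le_sum fun ω _ => mul_le_mul_of_nonneg_left (h.B_mem t ht ω).2 (hk0 ω)
  · simp only [expect, mixVal, Finset.mul_sum]
    rw [Finset.sum_comm]
    refine Finset.sum_congr rfl fun t ht => ?_
    have ht := Nat.lt_succ_iff.1 (Finset.mem_range.1 ht)
    have h₁ := hsumχ t ht _ (hpay.1.atomConst ht)
    have h₂ := hsumχS t ht _ (hpay.2.atomConst ht)
    simp only [mul_comm (a t _), mul_comm (A t _)]
    rw [Finset.sum_add_distrib, ← h₁, ← h₂, ← Finset.sum_add_distrib]
    exact Finset.sum_congr rfl fun ω _ => by ring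

end DualWeights

/-! ### The superhedging problem as a linear programme -/

section Superhedging

variable {M} {ξ ζ : ℕ → Ω → ℝ}

variable (M) in
/-- Triples `(x, α, β)` of a real number and a predictable strategy. -/
def predictablePlans : Submodule ℝ (ℝ × (ℕ → Ω → ℝ) × (ℕ → Ω → ℝ)) where
  carrier := {y | ∀ t, AtomConst (M.F (t - 1)) (y.2.1 t) ∧ AtomConst (M.F (t - 1)) (y.2.2 t)}
  add_mem' hy hz t :=
    ⟨fun ω ω' h => congrArg₂ (· + ·) ((hy t).1 ω ω' h) ((hz t).1 ω ω' h),
      fun ω ω' h => congrArg₂ (· + ·) ((hy t).2 ω ω' h) ((hz t).2 ω ω' h)⟩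
  zero_mem' _ := ⟨fun _ _ _ => rfl, fun _ _ _ => rfl⟩
  smul_mem' r _ hy t :=
    ⟨fun ω ω' h => congrArg (r * ·) ((hy t).1 ω ω' h),
      fun ω ω' h => congrArg (r * ·) ((hy t).2 ω ω' h)⟩

variable (M) in
/-- The ask price (`true`) or the bid price (`false`). -/
def sidePrice (t : ℕ) (ω : Ω) (side : Bool) : ℝ := if side then M.Sa t ω else M.Sb t ω

variable (M) in
/-- The value of a plan's position when stock is marked at the given side. -/
def positionValue (t : ℕ) (ω : Ω) (side : Bool) : predictablePlans M →ₗ[ℝ] ℝ where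
  toFun y := y.1.2.1 t ω + sidePrice M t ω side * y.1.2.2 t ω
  map_add' y z := by
    simp only [Submodule.coe_add, Prod.fst_add, Prod.snd_add, Pi.add_apply]
    ring
  map_smul' r y := by
    simp only [Submodule.coe_smul, Prod.smul_fst, Prod.smul_snd, Pi.smul_apply, smul_eq_mul,
      RingHom.id_apply]
    ring

variable (M) in
/-- The value of a plan's position carried to the next time, marked at current prices. -/
def carriedValue (t : ℕ) (ω : Ω) (side : Bool) : predictablePlans M →ₗ[ℝ] ℝ where
  toFun y := y.1.2.1 (t + 1) ω + sidePrice M t ω side * y.1.2.2 (t + 1) ω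
  map_add' y z := by
    simp only [Submodule.coe_add, Prod.fst_add, Prod.snd_add, Pi.add_apply]
    ring
  map_smul' r y := by
    simp only [Submodule.coe_smul, Prod.smul_fst, Prod.smul_snd, Pi.smul_apply, smul_eq_mul,
      RingHom.id_apply]
    ring

variable (M) in
/-- The endowment of a plan. -/
def endowment : predictablePlans M →ₗ[ℝ] ℝ :=
  LinearMap.fst ℝ ℝ ((ℕ → Ω → ℝ) × (ℕ → Ω → ℝ)) ∘ₗ (predictablePlans M).subtype

variable (M) in
/-- The constraints of the superhedging problem: covering the payoff, self-financing, and
affordability of the initial position. -/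
def constraintForm :
    (ℕ × Ω × Bool) ⊕ (ℕ × Ω × Bool) ⊕ (Ω × Bool) → predictablePlans M →ₗ[ℝ] ℝ
  | .inl (t, ω, side) => positionValue M t ω side
  | .inr (.inl (t, ω, side)) => positionValue M t ω side - carriedValue M t ω side
  | .inr (.inr (ω, side)) => endowment M - positionValue M 0 ω side

variable (M ξ ζ) in
/-- The lower bounds in the constraints of the superhedging problem. -/
def constraintBound : (ℕ × Ω × Bool) ⊕ (ℕ × Ω × Bool) ⊕ (Ω × Bool) → ℝ
  | .inl (t, ω, side) => ξ t ω + sidePrice M t ω side * ζ t ω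
  | .inr _ => 0

variable (M) in
/-- The relevant constraints of the superhedging problem. -/
def constraints : Finset ((ℕ × Ω × Bool) ⊕ (ℕ × Ω × Bool) ⊕ (Ω × Bool)) :=
  (Finset.range (M.T + 1) ×ˢ Finset.univ).disjSum
    ((Finset.range M.T ×ˢ Finset.univ).disjSum Finset.univ)

lemma sum_constraints (f : (ℕ × Ω × Bool) ⊕ (ℕ × Ω × Bool) ⊕ (Ω × Bool) → ℝ) :
    ∑ i ∈ constraints M, f i =
      ∑ t ∈ Finset.range (M.T + 1), ∑ ω, (f (.inl (t, ω, true)) + f (.inl (t, ω, false))) +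
      (∑ t ∈ Finset.range M.T, ∑ ω,
        (f (.inr (.inl (t, ω, true))) + f (.inr (.inl (t, ω, false)))) +
      ∑ ω, (f (.inr (.inr (ω, true))) + f (.inr (.inr (ω, false))))) := by
  simp only [constraints, Finset.sum_disjSum, Finset.sum_product, Fintype.sum_prod_type,
    Fintype.sum_bool]

lemma exists_constraintBound_le :
    ∃ y, ∀ i ∈ constraints M, constraintBound M ξ ζ i ≤ constraintForm M i y := by
  obtain ⟨K, hK⟩ := ((constraints M).image (constraintBound M ξ ζ)).exists_le
  refine ⟨⟨(K, fun _ _ => K, 0), fun _ => ⟨fun _ _ _ => rfl, fun _ _ _ => rfl⟩⟩, ?_⟩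
  rintro (⟨t, ω, side⟩ | ⟨t, ω, side⟩ | ⟨ω, side⟩) hi
  · simpa [constraintForm, positionValue] using hK _ (Finset.mem_image_of_mem _ hi)
  · simp [constraintForm, constraintBound, positionValue, carriedValue]
  · simp [constraintForm, constraintBound, positionValue, endowment]

lemma sellerHedge_of_constraints {y : predictablePlans M}
    (hy : ∀ i ∈ constraints M, constraintBound M ξ ζ i ≤ constraintForm M i y) :
    SellerHedge M ξ ζ y.1.2.1 y.1.2.2 ∧
      ∀ ω, 0 ≤ liq M 0 ω (y.1.1 - y.1.2.1 0 ω) (-y.1.2.2 0 ω) := by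
  have hmem := y.2
  refine ⟨⟨⟨measurable_iff_atomConst.2 (hmem 0).1, measurable_iff_atomConst.2 (hmem 0).2,
    fun t _ => ⟨measurable_iff_atomConst.2 (hmem (t + 1)).1,
      measurable_iff_atomConst.2 (hmem (t + 1)).2⟩, fun t ht ω => ?_⟩, fun τ hτ ω => ?_⟩,
    fun ω => ?_⟩
  · have h (side) := hy (.inr (.inl (t, ω, side))) (by simp [constraints, ht])
    have h₁ := h false
    have h₂ := h true
    simp [constraintForm, constraintBound, positionValue, carriedValue, sidePrice] at h₁ h₂
    rw [liq_nonneg_iff ht.le]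
    constructor <;> linarith
  · have ht := hτ.1 ω
    generalize τ ω = t at ht ⊢
    have h (side) := hy (.inl (t, ω, side)) (by simp [constraints, ht])
    have h₁ := h false
    have h₂ := h true
    simp [constraintForm, constraintBound, positionValue, sidePrice] at h₁ h₂
    rw [liq_nonneg_iff ht]
    constructor <;> linarith
  · have h (side) := hy (.inr (.inr (ω, side))) (by simp [constraints])
    have h₁ := h false
    have h₂ := h true
    simp [constraintForm, constraintBound, positionValue, endowment, sidePrice] at h₁ h₂
    rw [liq_nonneg_iff (Nat.zero_le _)]
    constructor <;> linarith

/-- Testing the stationarity condition on a position held at a single time. -/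
lemma sum_single_time {T n : ℕ} (hn : n < T) {a b : ℕ → Ω → ℝ} (hb : b T = 0) (g : Ω → ℝ) :
    ∑ t ∈ Finset.range (T + 1), ∑ ω, a t ω * (if t = n + 1 then g ω else 0) +
      ∑ t ∈ Finset.range T, ∑ ω,
        b t ω * ((if t = n + 1 then g ω else 0) - if t + 1 = n + 1 then g ω else 0) =
    ∑ ω, g ω * (a (n + 1) ω + b (n + 1) ω) - ∑ ω, g ω * b n ω := by
  have hsum (c : ℕ → Ω → ℝ) (s : Finset ℕ) (k : ℕ) :
      ∑ t ∈ s, ∑ ω, c t ω * (if t = k then g ω else 0) =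
        if k ∈ s then ∑ ω, g ω * c k ω else 0 := by
    rw [Finset.sum_comm]
    simp only [mul_ite, mul_zero, Finset.sum_ite_eq', mul_comm]
    split_ifs <;> simp
  have hb' : ∑ t ∈ Finset.range T, ∑ ω, b t ω * (if t = n + 1 then g ω else 0) =
      ∑ t ∈ Finset.range (T + 1), ∑ ω, b t ω * (if t = n + 1 then g ω else 0) := by
    rw [Finset.sum_range_succ, hb]
    simp
  simp only [mul_sub, Finset.sum_sub_distrib, add_left_inj, mul_add, Finset.sum_add_distrib]
  rw [hb', hsum, hsum, hsum]
  simp [hn]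
  ring

/-- Strong duality for the superhedging problem. -/
theorem exists_sellerHedge_dualWeights (hNA : ArbitrageFree M) :
    ∃ x α β a A b B, SellerHedge M ξ ζ α β ∧
      (∀ ω, 0 ≤ liq M 0 ω (x - α 0 ω) (-β 0 ω)) ∧ DualWeights M a A b B ∧
      x = ∑ t ∈ Finset.range (M.T + 1), ∑ ω, (a t ω * ξ t ω + A t ω * ζ t ω) := by
  obtain ⟨χ, P, S, hχ, hP⟩ := hNA.exists_memBarP
  obtain ⟨y, l, hy, hl, hstat, hval⟩ := exists_lp_optimal (constraints M) (constraintForm M)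
    (constraintBound M ξ ζ) (endowment M) exists_constraintBound_le fun y hy =>
      have h := sellerHedge_of_constraints hy
      expect_le_cost hP hχ h.1 h.2
  obtain ⟨hedge, hcost⟩ := sellerHedge_of_constraints hy
  set a : ℕ → Ω → ℝ := fun t ω => l (.inl (t, ω, true)) + l (.inl (t, ω, false)) with ha
  set A : ℕ → Ω → ℝ := fun t ω =>
    l (.inl (t, ω, true)) * M.Sa t ω + l (.inl (t, ω, false)) * M.Sb t ω with hA
  set b : ℕ → Ω → ℝ := fun t ω => if t < M.T then
    l (.inr (.inl (t, ω, true))) + l (.inr (.inl (t, ω, false))) else 0 with hb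
  set B : ℕ → Ω → ℝ := fun t ω => if t < M.T then
    l (.inr (.inl (t, ω, true))) * M.Sa t ω + l (.inr (.inl (t, ω, false))) * M.Sb t ω else 0
    with hB
  have hbT : b M.T = 0 := by
    ext ω
    simp [hb]
  have hBT : B M.T = 0 := by
    ext ω
    simp [hB]
  have hstat' : ∀ y : predictablePlans M, y.1.1 =
      (∑ t ∈ Finset.range (M.T + 1), ∑ ω, a t ω * y.1.2.1 t ω +
        ∑ t ∈ Finset.range M.T, ∑ ω, b t ω * (y.1.2.1 t ω - y.1.2.1 (t + 1) ω)) +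
      (∑ t ∈ Finset.range (M.T + 1), ∑ ω, A t ω * y.1.2.2 t ω +
        ∑ t ∈ Finset.range M.T, ∑ ω, B t ω * (y.1.2.2 t ω - y.1.2.2 (t + 1) ω)) +
      ∑ ω, (l (.inr (.inr (ω, true))) * (y.1.1 - y.1.2.1 0 ω - M.Sa 0 ω * y.1.2.2 0 ω) +
        l (.inr (.inr (ω, false))) * (y.1.1 - y.1.2.1 0 ω - M.Sb 0 ω * y.1.2.2 0 ω)) := by
    intro y
    have h := hstat y
    rw [sum_constraints] at h
    refine h.trans ?_
    rw [← add_assoc, add_add_add_comm, ← Finset.sum_add_distrib, ← Finset.sum_add_distrib]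
    congr 1
    · congr 1
      · refine Finset.sum_congr rfl fun t _ => ?_
        rw [← Finset.sum_add_distrib]
        refine Finset.sum_congr rfl fun ω _ => ?_
        simp [constraintForm, positionValue, sidePrice, ha, hA]
        ring
      · refine Finset.sum_congr rfl fun t ht => ?_
        rw [← Finset.sum_add_distrib]
        refine Finset.sum_congr rfl fun ω _ => ?_
        simp [constraintForm, positionValue, carriedValue, sidePrice, hb, hB,
          Finset.mem_range.1 ht]
        ring
    · refine Finset.sum_congr rfl fun ω _ => ?_
      simp [constraintForm, positionValue, endowment, sidePrice]
      ring
  have hside (t ω) (ht : t ≤ M.T) (p q : ℝ) (hp : 0 ≤ p) (hq : 0 ≤ q) :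
      (p + q) * M.Sb t ω ≤ p * M.Sa t ω + q * M.Sb t ω ∧
        p * M.Sa t ω + q * M.Sb t ω ≤ (p + q) * M.Sa t ω := by
    have h := M.Sb_le_Sa t ω ht
    have hp' := mul_le_mul_of_nonneg_left h hp
    have hq' := mul_le_mul_of_nonneg_left h hq
    constructor <;> linarith
  have hplan (n : ℕ) (g : Ω → ℝ) (hg : AtomConst (M.F n) g) (t : ℕ) :
      AtomConst (M.F (t - 1)) fun ω => if t = n + 1 then g ω else 0 := by
    intro ω ω' hω
    dsimp only
    split_ifs with h
    · subst h
      exact hg ω ω' hω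
    · rfl
  refine ⟨y.1.1, y.1.2.1, y.1.2.2, a, A, b, B, hedge, hcost, ?_, ?_⟩
  · exact {
      a_nonneg := fun t ω => add_nonneg (hl _) (hl _)
      b_nonneg := fun t ω => by
        simp only [hb]
        split_ifs
        · exact add_nonneg (hl _) (hl _)
        · exact le_rfl
      b_horizon := hbT
      B_horizon := hBT
      A_mem := fun t ht ω => hside t ω ht _ _ (hl _) (hl _)
      B_mem := fun t ht ω => by
        simp only [hb, hB]
        split_ifs
        · exact hside t ω ht _ _ (hl _) (hl _)
        · simp
      sum_zero := by
        have h := hstat' ⟨(1, fun t _ => if t = 0 then 1 else 0, 0),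
          fun _ => ⟨fun _ _ _ => rfl, fun _ _ _ => rfl⟩⟩
        obtain ⟨T, hT⟩ := Nat.exists_eq_succ_of_ne_zero M.T_pos.ne'
        simp [hT] at h
        rw [Finset.sum_add_distrib]
        exact h.symm
      flow := fun t ht g hg => by
        have h := hstat' ⟨(0, fun s ω => if s = t + 1 then g ω else 0, 0),
          fun s => ⟨hplan t g hg s, fun _ _ _ => rfl⟩⟩
        dsimp only at h
        rw [sum_single_time ht hbT] at h
        simp at h
        linarith
      flow' := fun t ht g hg => by
        have h := hstat' ⟨(0, 0, fun s ω => if s = t + 1 then g ω else 0),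
          fun s => ⟨fun _ _ _ => rfl, hplan t g hg s⟩⟩
        dsimp only at h
        rw [sum_single_time ht hBT] at h
        simp at h
        linarith }
  · refine hval.trans ?_
    rw [sum_constraints]
    simp only [constraintBound, mul_zero, add_zero, Finset.sum_const_zero, sidePrice, ha, hA]
    refine Finset.sum_congr rfl fun t _ => Finset.sum_congr rfl fun ω _ => ?_
    simp
    ring

end Superhedging

/-- Theorem (seller's price representation): in an arbitrage-free model the infimum
defining the ask price is attained, there are a mixed stopping time and an approximate
martingale realising the ask price, and every such pair gives expectation ≤ ask price. -/
theorem seller_price_representation (ξ ζ : ℕ → Ω → ℝ)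
    (hpay : AdaptedPair M ξ ζ) (hNA : ArbitrageFree M) :
    (∃ α β, SellerHedge M ξ ζ α β ∧
        ∀ ω, -liq M 0 ω (-α 0 ω) (-β 0 ω) = askPrice M ξ ζ) ∧
    (∃ χ P S, IsMixedStop M χ ∧ memBarP M χ P S ∧
        askPrice M ξ ζ =
          expect P (mixVal M χ fun t ω => ξ t ω + S t ω * ζ t ω)) ∧
    (∀ χ P S, IsMixedStop M χ → memBarP M χ P S →
        expect P (mixVal M χ fun t ω => ξ t ω + S t ω * ζ t ω) ≤ askPrice M ξ ζ) := by
  obtain ⟨x, α, β, a, A, b, B, hedge, hcost, hdual, hx⟩ :=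
    exists_sellerHedge_dualWeights (ξ := ξ) (ζ := ζ) hNA
  obtain ⟨χ, P, S, hχ, hP, hval⟩ := hdual.atomAverage.exists_memBarP
    (fun t _ => atomConst_atomAverage a t) (fun t _ => atomConst_atomAverage b t)
    (fun t _ => atomConst_atomAverage A t)
  have hxP : x = expect P (mixVal M χ fun t ω => ξ t ω + S t ω * ζ t ω) := by
    rw [hx, hval ξ ζ hpay]
    refine Finset.sum_congr rfl fun t ht => ?_
    have ht := Nat.lt_succ_iff.1 (Finset.mem_range.1 ht)
    simp only [Finset.sum_add_distrib, mul_comm _ (ξ t _), mul_comm _ (ζ t _)]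
    rw [sum_mul_atomAverage a (hpay.1.atomConst ht), sum_mul_atomAverage A (hpay.2.atomConst ht)]
  have hlower : ∀ y α β, SellerHedge M ξ ζ α β →
      (∀ ω, 0 ≤ liq M 0 ω (y - α 0 ω) (-β 0 ω)) → x ≤ y := fun y α β h hy =>
    hxP ▸ expect_le_cost hP hχ h hy
  have hshift : ∀ y ω γ δ, liq M 0 ω (y - γ) δ = y + liq M 0 ω (-γ) δ := fun y ω γ δ => by
    simp only [liq]
    ring
  have hattained : ∀ ω, x = -liq M 0 ω (-α 0 ω) (-β 0 ω) := by
    intro ω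
    have hconst : ∀ ω', liq M 0 ω' (-α 0 ω') (-β 0 ω') = liq M 0 ω (-α 0 ω) (-β 0 ω) := by
      intro ω'
      have hω : sameAtom (M.F 0) ω' ω := fun C hC => by
        rw [M.F_zero] at hC
        rcases MeasurableSpace.measurableSet_bot_iff.1 hC with rfl | rfl <;> simp
      obtain ⟨hα, hβ⟩ := hedge.1.atomConst (Nat.zero_le _)
      rw [liq, liq, hα _ _ hω, hβ _ _ hω,
        IsAdapted.atomConst M.Sb_adapted (Nat.zero_le _) _ _ hω,
        IsAdapted.atomConst M.Sa_adapted (Nat.zero_le _) _ _ hω]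
    refine le_antisymm (hlower _ α β hedge fun ω' => ?_) ?_
    · rw [hshift, hconst ω', neg_add_cancel]
    · have := hcost ω
      rw [hshift] at this
      linarith
  have hask : askPrice M ξ ζ = x := by
    refine IsLeast.csInf_eq ⟨⟨α, β, hedge, hattained⟩, ?_⟩
    rintro y ⟨α', β', hedge', hy⟩
    refine hlower y α' β' hedge' fun ω => ?_
    rw [hshift, hy ω, neg_add_cancel]
  rw [hask]
  exact ⟨⟨α, β, hedge, fun ω => (hattained ω).symm⟩, ⟨χ, P, S, hχ, hP, hxP⟩,
    fun χ P S hχ hP => expect_le_cost hP hχ hedge hcost⟩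

end RZ
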